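/- arXiv:2308.02656 — 2 statements merged into one kernel-verified Lean document; each statement's English description precedes it below -/
import Mathlib

section
/- Let a, b, c be real numbers such that |a + b + c| < 1 and a² + b² + c² - ab - ac - bc < 1, and let V = [[c, b, a], [a, c, b], [b, a, c]]. Then the orbit V^n · (a, b, c)^T converges to the origin (0, 0, 0)^T as n → ∞. -/
open Filter

/-- If `|a + b + c| < 1` and `a² + b² + c² - ab - ac - bc < 1`, the orbit of
`(a, b, c)ᵀ` under the circulant matrix `V = [[c,b,a],[a,c,b],[b,a,c]]` converges
to the origin. -/
theorem quadratic_orbit_tendsto_zero (a b c : ℝ)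
    (h1 : |a + b + c| < 1)
    (h2 : a ^ 2 + b ^ 2 + c ^ 2 - a * b - a * c - b * c < 1) :
    Tendsto
      (fun n : ℕ => ((Matrix.of ![![c, b, a], ![a, c, b], ![b, a, c]]) ^ n).mulVec ![a, b, c])
      atTop (nhds ![(0 : ℝ), 0, 0]) := by
  set v : ℕ → Fin 3 → ℝ := fun n : ℕ =>
    ((Matrix.of ![![c, b, a], ![a, c, b], ![b, a, c]]) ^ n).mulVec ![a, b, c] with hv
  set q := a ^ 2 + b ^ 2 + c ^ 2 - a * b - a * c - b * c with hq
  have hq0 : 0 ≤ q := by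
    nlinarith [sq_nonneg (a - b), sq_nonneg (a - c), sq_nonneg (b - c)]
  have hstep : ∀ n, v (n + 1) =
      (Matrix.of ![![c, b, a], ![a, c, b], ![b, a, c]]).mulVec (v n) := by
    intro n
    simp only [hv, pow_succ', Matrix.mulVec_mulVec]
  have e0 : ∀ n, v (n + 1) 0 = c * v n 0 + b * v n 1 + a * v n 2 := by
    intro n
    rw [hstep]
    simp [Matrix.mulVec, dotProduct, Fin.sum_univ_three]
  have e1 : ∀ n, v (n + 1) 1 = a * v n 0 + c * v n 1 + b * v n 2 := by
    intro n
    rw [hstep]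
    simp [Matrix.mulVec, dotProduct, Fin.sum_univ_three]
  have e2 : ∀ n, v (n + 1) 2 = b * v n 0 + a * v n 1 + c * v n 2 := by
    intro n
    rw [hstep]
    simp [Matrix.mulVec, dotProduct, Fin.sum_univ_three]
  have hS : ∀ n, v n 0 + v n 1 + v n 2 = (a + b + c) ^ n * (v 0 0 + v 0 1 + v 0 2) := by
    intro n
    induction n with
    | zero => simp
    | succ k ih =>
      rw [e0, e1, e2, pow_succ]
      linear_combination (a + b + c) * ih
  have hQ : ∀ n, v n 0 ^ 2 + v n 1 ^ 2 + v n 2 ^ 2 - v n 0 * v n 1 - v n 0 * v n 2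
      - v n 1 * v n 2 = q ^ n * (v 0 0 ^ 2 + v 0 1 ^ 2 + v 0 2 ^ 2 - v 0 0 * v 0 1
        - v 0 0 * v 0 2 - v 0 1 * v 0 2) := by
    intro n
    induction n with
    | zero => simp
    | succ k ih =>
      rw [e0, e1, e2, pow_succ]
      linear_combination q * ih
  have tS : Tendsto (fun n => v n 0 + v n 1 + v n 2) atTop (nhds 0) := by
    have := (tendsto_pow_atTop_nhds_zero_of_abs_lt_one h1).mul_const (v 0 0 + v 0 1 + v 0 2)
    rw [zero_mul] at this
    exact this.congr fun n => (hS n).symm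
  have tQ : Tendsto (fun n => v n 0 ^ 2 + v n 1 ^ 2 + v n 2 ^ 2 - v n 0 * v n 1 - v n 0 * v n 2
      - v n 1 * v n 2) atTop (nhds 0) := by
    have := (tendsto_pow_atTop_nhds_zero_of_lt_one hq0 h2).mul_const
      (v 0 0 ^ 2 + v 0 1 ^ 2 + v 0 2 ^ 2 - v 0 0 * v 0 1 - v 0 0 * v 0 2 - v 0 1 * v 0 2)
    rw [zero_mul] at this
    exact this.congr fun n => (hQ n).symm
  have tN : Tendsto (fun n => v n 0 ^ 2 + v n 1 ^ 2 + v n 2 ^ 2) atTop (nhds 0) := by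
    have := ((tS.pow 2).add (tQ.const_mul 2)).mul_const (1 / 3 : ℝ)
    norm_num at this
    refine this.congr fun n => ?_
    ring
  have key : ∀ i : Fin 3, Tendsto (fun n => v n i) atTop (nhds 0) := by
    intro i
    have hsq : Tendsto (fun n => v n i ^ 2) atTop (nhds 0) := by
      refine squeeze_zero (fun n => sq_nonneg _) (fun n => ?_) tN
      fin_cases i <;> dsimp <;>
        nlinarith [sq_nonneg (v n 0), sq_nonneg (v n 1), sq_nonneg (v n 2)]
    have := hsq.sqrt
    simp only [Real.sqrt_sq_eq_abs, Real.sqrt_zero] at this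
    exact (tendsto_zero_iff_abs_tendsto_zero _).2 this
  rw [tendsto_pi_nhds]
  intro i
  have hi : (![(0 : ℝ), 0, 0]) i = 0 := by fin_cases i <;> rfl
  rw [hi]
  exact key i
end

section
/- Let p(t) = (-1 + 2t + 2t²)/3 ∈ ℚ[t]. For all natural numbers k ≥ 1 and n, the polynomial (t·p(t))^k - (t·p(t))^{k+6n} is divisible by 1 - t³ in ℚ[t], and the quotient polynomial q(t) = ((t·p(t))^k - (t·p(t))^{k+6n})/(1 - t³) satisfies q(1) = 6n. -/
open Polynomial

/-- For `p(t) = (-1 + 2t + 2t²)/3` over ℚ, `k ≥ 1` and `n ∈ ℕ`, the polynomial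
`(t·p(t))^k - (t·p(t))^(k+6n)` is divisible by `1 - t³`, and the quotient `q`
satisfies `q(1) = 6n`. -/
theorem key_divisibility_and_evaluation
    (p : Polynomial ℚ)
    (hp : p = Polynomial.C (-1/3 : ℚ) + Polynomial.C (2/3 : ℚ) * Polynomial.X +
      Polynomial.C (2/3 : ℚ) * Polynomial.X ^ 2) :
    ∀ k : ℕ, 1 ≤ k → ∀ n : ℕ,
      ∃ q : Polynomial ℚ,
        (Polynomial.X * p) ^ k - (Polynomial.X * p) ^ (k + 6 * n) =
          (1 - Polynomial.X ^ 3) * q ∧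
        q.eval 1 = 6 * n := by
  intro k _ n
  obtain ⟨f, hf⟩ : ∃ f, f = X * p := ⟨_, rfl⟩
  rw [← hf]
  have ha : 3 * (C (1/3 : ℚ)) = 1 := by
    rw [show (3 : ℚ[X]) = C 3 from rfl, ← C_mul]
    norm_num
  have h1 : C (-1/3 : ℚ) = -C (1/3 : ℚ) := by
    rw [← C_neg]
    norm_num
  have h2 : C (2/3 : ℚ) = 2 * C (1/3 : ℚ) := by
    rw [show (2 : ℚ[X]) = C 2 from rfl, ← C_mul]
    norm_num
  have hf1 : f.eval 1 = 1 := by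
    rw [hf, hp]
    simp
    norm_num
  rw [hp, h1, h2] at hf
  have hA : 1 - f = (1 - X) * (C (1/3 : ℚ) * (3 + 4 * X + 2 * X ^ 2)) := by
    rw [hf]
    linear_combination -ha
  have hB : f + X = 2 * C (1/3 : ℚ) * X * (1 + X + X ^ 2) := by
    rw [hf]
    linear_combination -X * ha
  obtain ⟨g, hg, hg1⟩ : ∃ g : ℚ[X], 1 - f ^ 6 = (1 - X ^ 3) * g ∧ g.eval 1 = 6 := by
    refine ⟨(C (1/3 : ℚ) * (3 + 4 * X + 2 * X ^ 2)) * ((1 + f) * (1 + f + f ^ 2)) *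
      (2 * C (1/3 : ℚ) * X * (f - X - 1) + 1), ?_, ?_⟩
    · have hC : 1 - f + f ^ 2 =
          (1 + X + X ^ 2) * (2 * C (1/3 : ℚ) * X * (f - X - 1) + 1) := by
        linear_combination (f - X - 1) * hB
      calc 1 - f ^ 6 = (1 - f) * ((1 + f) * (1 + f + f ^ 2)) * (1 - f + f ^ 2) := by ring
        _ = _ := by
          rw [hC, hA]
          ring
    · simp only [eval_mul, eval_add, eval_sub, eval_pow, eval_C, eval_X, eval_one,
        eval_ofNat, hf1]
      norm_num
  refine ⟨f ^ k * g * ∑ i ∈ Finset.range n, (f ^ 6) ^ i, ?_, ?_⟩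
  · have hs := mul_neg_geom_sum (f ^ 6) n
    rw [hg] at hs
    rw [pow_add, pow_mul]
    linear_combination -f ^ k * hs
  · simp [eval_finset_sum, hf1, hg1]
end
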